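/- Khovanov homology of the Hopf link via its cube of resolutions: let R = ℤ and let A be the Khovanov Frobenius algebra over ℤ. Define d⁰ : A ⊗ A → A × A by d⁰(z) = (m(z), m(z)) and d¹ : A × A → A ⊗ A by d¹(a, b) = Δ(a) − Δ(b). Then: (i) d¹ ∘ d⁰ = 0; (ii) the kernel of d⁰ is a free ℤ-module of rank 2; (iii) the kernel of d¹ equals the range of d⁰ (so the homology at the middle term vanishes); and (iv) the quotient (A ⊗ A)/range(d¹) is a free ℤ-module of rank 2. (This computes the Khovanov homology of the positive Hopf link from its two-crossing cube of resolutions: it is free of total rank 4, concentrated in homological gradings 0 and 2.) -/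

import Mathlib

open TensorProduct

noncomputable section

variable (R : Type*) [CommRing R]

/-- The merge map (multiplication) of the Khovanov Frobenius algebra
`A = R[x]/(x²) = DualNumber R`:  `m(a ⊗ b) = a * b`, so `m(1⊗1) = 1`,
`m(1⊗x) = m(x⊗1) = x`, `m(x⊗x) = 0`. -/
def khMul : DualNumber R ⊗[R] DualNumber R →ₗ[R] DualNumber R := LinearMap.mul' R (DualNumber R)

/-- The split map (comultiplication) `Δ` of the Khovanov Frobenius algebra:
`Δ(1) = 1⊗x + x⊗1`, `Δ(x) = x⊗x`, where `x = DualNumber.eps`. -/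
def khComul : DualNumber R →ₗ[R] DualNumber R ⊗[R] DualNumber R where
  toFun a := TrivSqZeroExt.fst a •
      ((1 : DualNumber R) ⊗ₜ[R] (DualNumber.eps : DualNumber R)
        + (DualNumber.eps : DualNumber R) ⊗ₜ[R] (1 : DualNumber R))
    + TrivSqZeroExt.snd a •
      ((DualNumber.eps : DualNumber R) ⊗ₜ[R] (DualNumber.eps : DualNumber R))
  map_add' a b := by
    simp [add_smul]
    abel
  map_smul' r a := by
    simp [smul_smul, smul_add]

/-- The differential `d⁰ : A ⊗ A → A × A` out of the `00`-vertex of the cube of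
resolutions of the two-crossing diagram of the positive Hopf link: both components
are the merge map `m`. -/
def hopfD0 : DualNumber ℤ ⊗[ℤ] DualNumber ℤ →ₗ[ℤ] DualNumber ℤ × DualNumber ℤ :=
  LinearMap.prod (khMul ℤ) (khMul ℤ)

/-- The differential `d¹ : A × A → A ⊗ A` into the `11`-vertex of the cube of
resolutions of the positive Hopf link: `d¹(a, b) = Δ(a) − Δ(b)`. -/
def hopfD1 : DualNumber ℤ × DualNumber ℤ →ₗ[ℤ] DualNumber ℤ ⊗[ℤ] DualNumber ℤ :=
  khComul ℤ ∘ₗ LinearMap.fst ℤ (DualNumber ℤ) (DualNumber ℤ)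
    - khComul ℤ ∘ₗ LinearMap.snd ℤ (DualNumber ℤ) (DualNumber ℤ)

instance DualNumber.moduleFree : Module.Free R (DualNumber R) :=
  inferInstanceAs (Module.Free R (R × R))

instance DualNumber.moduleFinite : Module.Finite R (DualNumber R) :=
  inferInstanceAs (Module.Finite R (R × R))

theorem DualNumber.finrank_eq_two [Nontrivial R] : Module.finrank R (DualNumber R) = 2 :=
  (Module.finrank_prod (R := R) (M := R) (M' := R)).trans (by simp)

theorem DualNumber.finrank_tensor_self [Nontrivial R] :
    Module.finrank R (DualNumber R ⊗[R] DualNumber R) = 4 := by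
  rw [Module.finrank_tensorProduct, DualNumber.finrank_eq_two]

theorem khMul_surjective : Function.Surjective (khMul R) := fun a =>
  ⟨1 ⊗ₜ a, by simp [khMul]⟩

/-- The left counit law `(ε ⊗ id) ∘ Δ = id` of the Khovanov Frobenius algebra. -/
theorem counit_rTensor_comp_khComul :
    ((TensorProduct.lid R (DualNumber R)).toLinearMap ∘ₗ
      (TrivSqZeroExt.sndHom R R).rTensor (DualNumber R)) ∘ₗ khComul R = LinearMap.id := by
  ext a <;> simp [khComul]

theorem khComul_injective : Function.Injective (khComul R) := fun a b h => by
  simpa only [← LinearMap.comp_apply, counit_rTensor_comp_khComul, LinearMap.id_apply] using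
    congrArg ((TensorProduct.lid R (DualNumber R)).toLinearMap ∘ₗ
      (TrivSqZeroExt.sndHom R R).rTensor (DualNumber R)) h

/-- The cokernel of a split injection into a projective module is projective. -/
theorem Module.Projective.quotient_range_of_comp_eq_id {R M N : Type*} [Ring R]
    [AddCommGroup M] [AddCommGroup N] [Module R M] [Module R N] [Module.Projective R N]
    (f : M →ₗ[R] N) (g : N →ₗ[R] M) (h : g ∘ₗ f = LinearMap.id) :
    Module.Projective R (N ⧸ LinearMap.range f) := by
  have hgf (x : M) : g (f x) = x := LinearMap.congr_fun h x
  refine .of_split ((LinearMap.range f).liftQ (LinearMap.id - f ∘ₗ g) ?_)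
    (LinearMap.range f).mkQ ?_
  · rintro _ ⟨x, rfl⟩
    simp [hgf]
  · ext x
    simp [Submodule.Quotient.mk_sub, (Submodule.Quotient.mk_eq_zero _).2]

theorem finrank_ker_khMul [IsDomain R] :
    Module.finrank R (LinearMap.ker (khMul R)) = 2 := by
  have h := (LinearMap.ker (khMul R)).finrank_quotient_add_finrank
  rw [((khMul R).quotKerEquivOfSurjective (khMul_surjective R)).finrank_eq,
    DualNumber.finrank_eq_two, DualNumber.finrank_tensor_self] at h
  omega

theorem free_quotient_range_khComul [IsDomain R] [IsPrincipalIdealRing R] :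
    Module.Free R ((DualNumber R ⊗[R] DualNumber R) ⧸ LinearMap.range (khComul R)) := by
  have := Module.Projective.quotient_range_of_comp_eq_id _ _ (counit_rTensor_comp_khComul R)
  exact Module.free_of_finite_type_torsion_free'

theorem finrank_quotient_range_khComul [IsDomain R] :
    Module.finrank R ((DualNumber R ⊗[R] DualNumber R) ⧸ LinearMap.range (khComul R)) = 2 := by
  have h := (LinearMap.range (khComul R)).finrank_quotient_add_finrank
  rw [LinearMap.finrank_range_of_inj (khComul_injective R), DualNumber.finrank_eq_two,
    DualNumber.finrank_tensor_self] at h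
  omega

/-- The difference of two copies of `f` has the same range as `f`. -/
theorem LinearMap.range_comp_fst_sub_comp_snd {R M N : Type*} [Ring R] [AddCommGroup M]
    [AddCommGroup N] [Module R M] [Module R N] (f : M →ₗ[R] N) :
    range (f ∘ₗ fst R M M - f ∘ₗ snd R M M) = range f := by
  apply le_antisymm
  · rintro _ ⟨⟨a, b⟩, rfl⟩
    exact ⟨a - b, by simp⟩
  · rintro _ ⟨a, rfl⟩
    exact ⟨(a, 0), by simp⟩

/-- The difference of two copies of an injective map vanishes exactly on the diagonal, which is the
range of a doubled surjective map. -/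
theorem LinearMap.ker_comp_fst_sub_comp_snd {R L M N : Type*} [Ring R] [AddCommGroup L]
    [AddCommGroup M] [AddCommGroup N] [Module R L] [Module R M] [Module R N]
    {f : M →ₗ[R] N} (hf : Function.Injective f) {g : L →ₗ[R] M} (hg : Function.Surjective g) :
    ker (f ∘ₗ fst R M M - f ∘ₗ snd R M M) = range (g.prod g) := by
  ext ⟨a, b⟩
  have hab : (a, b) ∈ ker (f ∘ₗ fst R M M - f ∘ₗ snd R M M) ↔ a = b := by
    simp [sub_eq_zero, hf.eq_iff]
  rw [hab]
  constructor
  · rintro rfl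
    obtain ⟨z, hz⟩ := hg a
    exact ⟨z, Prod.ext hz hz⟩
  · rintro ⟨z, hz⟩
    exact (congrArg Prod.fst hz).symm.trans (congrArg Prod.snd hz)

/-- The homology of the Hopf link cube of resolutions over a principal ideal domain. -/
theorem hopf_cube_homology [IsDomain R] [IsPrincipalIdealRing R] :
    letI d₀ := (khMul R).prod (khMul R)
    letI d₁ := khComul R ∘ₗ LinearMap.fst R (DualNumber R) (DualNumber R)
      - khComul R ∘ₗ LinearMap.snd R (DualNumber R) (DualNumber R)
    (d₁ ∘ₗ d₀ = 0)
    ∧ (Module.Free R (LinearMap.ker d₀) ∧ Module.finrank R (LinearMap.ker d₀) = 2)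
    ∧ (LinearMap.ker d₁ = LinearMap.range d₀)
    ∧ (Module.Free R ((DualNumber R ⊗[R] DualNumber R) ⧸ LinearMap.range d₁)
        ∧ Module.finrank R ((DualNumber R ⊗[R] DualNumber R) ⧸ LinearMap.range d₁) = 2) := by
  have hker := LinearMap.ker_comp_fst_sub_comp_snd (khComul_injective R) (khMul_surjective R)
  refine ⟨LinearMap.range_le_ker_iff.1 hker.ge, ⟨?_, ?_⟩, hker, ?_⟩
  · obtain ⟨n, ⟨b⟩⟩ := Submodule.nonempty_basis_of_pid
      (Module.Free.chooseBasis R (DualNumber R ⊗[R] DualNumber R))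
      (LinearMap.ker ((khMul R).prod (khMul R)))
    exact .of_basis b
  · rw [LinearMap.ker_prod, inf_idem]
    exact finrank_ker_khMul R
  · rw [LinearMap.range_comp_fst_sub_comp_snd]
    exact ⟨free_quotient_range_khComul R, finrank_quotient_range_khComul R⟩

/-- Khovanov homology of the positive Hopf link from its two-crossing cube of
resolutions: (i) `d¹ ∘ d⁰ = 0`; (ii) `ker d⁰` is free of rank `2` over `ℤ`;
(iii) `ker d¹ = range d⁰` (the middle homology vanishes); and (iv) the quotient
`(A ⊗ A)/range d¹` is free of rank `2` over `ℤ`.  Hence the Khovanov homology of the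
positive Hopf link is free of total rank `4`, concentrated in homological gradings
`0` and `2`. -/
theorem khovanov_hopf_link :
    (hopfD1 ∘ₗ hopfD0 = 0)
    ∧ (Module.Free ℤ (LinearMap.ker hopfD0) ∧ Module.finrank ℤ (LinearMap.ker hopfD0) = 2)
    ∧ (LinearMap.ker hopfD1 = LinearMap.range hopfD0)
    ∧ (Module.Free ℤ ((DualNumber ℤ ⊗[ℤ] DualNumber ℤ) ⧸ LinearMap.range hopfD1)
        ∧ Module.finrank ℤ ((DualNumber ℤ ⊗[ℤ] DualNumber ℤ) ⧸ LinearMap.range hopfD1) = 2) := by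
  exact hopf_cube_homology ℤ
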